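/- Let G be a group, H ≤ G, and A ≤ G with AH = G. The map U ↦ U ∩ A is a bijection from the set of subgroups U with H ≤ U ≤ G to the set of subgroups J with H ∩ A ≤ J ≤ A satisfying JH = HJ (as subsets of G). -/

import Mathlib

open scoped Pointwise

namespace Subgroup

variable {G : Type*} [Group G]

theorem coe_inf_mul_of_le_of_mul_eq_univ {H A U : Subgroup G}
    (hAH : (A : Set G) * (H : Set G) = Set.univ) (hU : H ≤ U) :
    ((U ⊓ A : Subgroup G) : Set G) * (H : Set G) = U := by
  rw [inf_mul_assoc U A H hU, hAH]
  exact Set.inter_univ _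

theorem mul_coe_inf_of_le_of_mul_eq_univ {H A U : Subgroup G}
    (hAH : (A : Set G) * (H : Set G) = Set.univ) (hU : H ≤ U) :
    (H : Set G) * ((U ⊓ A : Subgroup G) : Set G) = U := by
  simpa only [mul_inv_rev, inv_coe_set] using
    congrArg (·⁻¹) (coe_inf_mul_of_le_of_mul_eq_univ hAH hU)

/-- The product of two permuting subgroups, as a subgroup. -/
def mulOfPermuting (J H : Subgroup G)
    (h : (J : Set G) * (H : Set G) = (H : Set G) * (J : Set G)) : Subgroup G where
  carrier := (J : Set G) * (H : Set G)
  one_mem' := ⟨1, J.one_mem, 1, H.one_mem, one_mul 1⟩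
  mul_mem' {a b} ha hb := by
    have key : ((J : Set G) * H) * ((J : Set G) * H) = (J : Set G) * H := by
      rw [mul_assoc, ← mul_assoc (H : Set G), ← h, mul_assoc, coe_mul_coe, ← mul_assoc,
        coe_mul_coe]
    exact key ▸ Set.mul_mem_mul ha hb
  inv_mem' {a} ha := by
    have key : ((J : Set G) * (H : Set G))⁻¹ = (J : Set G) * H := by
      rw [mul_inv_rev, inv_coe_set, inv_coe_set, h]
    exact key ▸ Set.inv_mem_inv.mpr ha

end Subgroup

/-- The map `U ↦ U ⊓ A` is a bijection from subgroups between `H` and `G` to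
subgroups `J` between `H ⊓ A` and `A` with `JH = HJ`. -/
theorem stmt_1 {G : Type*} [Group G] (H A : Subgroup G)
    (hAH : (A : Set G) * (H : Set G) = Set.univ) :
    Set.BijOn (fun U : Subgroup G => U ⊓ A)
      {U : Subgroup G | H ≤ U}
      {J : Subgroup G | H ⊓ A ≤ J ∧ J ≤ A ∧
        (J : Set G) * (H : Set G) = (H : Set G) * (J : Set G)} := by
  refine ⟨fun U hU => ⟨inf_le_inf_right A hU, inf_le_right, ?_⟩, fun U hU V hV hUV => ?_, ?_⟩
  · exact (Subgroup.coe_inf_mul_of_le_of_mul_eq_univ hAH hU).trans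
      (Subgroup.mul_coe_inf_of_le_of_mul_eq_univ hAH hU).symm
  · apply SetLike.coe_injective
    rw [← Subgroup.coe_inf_mul_of_le_of_mul_eq_univ hAH hU,
      ← Subgroup.coe_inf_mul_of_le_of_mul_eq_univ hAH hV]
    exact congrArg (fun J : Subgroup G => (J : Set G) * (H : Set G)) hUV
  · rintro J ⟨hHJ, hJA, hJH⟩
    refine ⟨Subgroup.mulOfPermuting J H hJH,
      fun x hx => ⟨1, J.one_mem, x, hx, one_mul x⟩, le_antisymm ?_ fun x hx => ?_⟩
    · rintro _ ⟨⟨j, hj, x, hx, rfl⟩, hA⟩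
      exact J.mul_mem hj (hHJ ⟨hx, (A.mul_mem_cancel_left (hJA hj)).mp hA⟩)
    · exact ⟨⟨x, hx, 1, H.one_mem, mul_one x⟩, hJA hx⟩
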